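/- Under Assumption A, if α > 3 and argmin φ ≠ ∅, then the trajectory converges weakly: there exists x∞ ∈ argmin φ such that x(t) ⇀ x∞ in H as t → ∞ (i.e., ⟨x(t), y⟩ → ⟨x∞, y⟩ for every y ∈ H). -/

import Mathlib

open scoped BigOperators
open Set Filter MeasureTheory

/-- The supremum function `φ(x) = max_{λ ∈ Q} ∑ i, λ_i g_i(x)`. -/
noncomputable def phi {H : Type*} (m : ℕ) (g : Fin m → H → ℝ)
    (Q : Set (EuclideanSpace ℝ (Fin m))) (x : H) : ℝ :=
  sSup ((fun l : EuclideanSpace ℝ (Fin m) => ∑ i, l i * g i x) '' Q)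

/-- The regularized function `φ_μ(x) = max_{λ ∈ Q} ( ∑ i, λ_i g_i(x) - μ D(λ) )`. -/
noncomputable def phiMu {H : Type*} (m : ℕ) (g : Fin m → H → ℝ)
    (Q : Set (EuclideanSpace ℝ (Fin m))) (D : EuclideanSpace ℝ (Fin m) → ℝ)
    (μ : ℝ) (x : H) : ℝ :=
  sSup ((fun l : EuclideanSpace ℝ (Fin m) => ∑ i, l i * g i x - μ * D l) '' Q)

namespace S16
open Topology

lemma grad_ineq {H : Type*} [NormedAddCommGroup H] [InnerProductSpace ℝ H] [CompleteSpace H]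
    {f : H → ℝ} (hf : ConvexOn ℝ Set.univ f) (hd : Differentiable ℝ f) (p y : H) :
    f p + inner ℝ (gradient f p) (y - p) ≤ f y := by
  have h1 : HasDerivAt (fun s : ℝ => p + s • (y - p)) (y - p) 0 := by
    have := ((hasDerivAt_id (0:ℝ)).smul_const (y - p)).const_add p
    simpa using this
  have h2 : HasFDerivAt f ((InnerProductSpace.toDual ℝ H) (gradient f p)) (p + (0:ℝ) • (y - p)) := by
    simpa using (hd p).hasGradientAt.hasFDerivAt
  have h3 : HasDerivAt (fun s : ℝ => f (p + s • (y - p))) (inner ℝ (gradient f p) (y - p)) 0 := by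
    have := h2.comp_hasDerivAt (0:ℝ) h1
    simpa [Function.comp_def] using this
  have hc : ConvexOn ℝ Set.univ (fun s : ℝ => f (p + s • (y - p))) := by
    refine ⟨convex_univ, ?_⟩
    intro a _ b _ u v hu hv huv
    have := hf.2 (mem_univ (p + a • (y - p))) (mem_univ (p + b • (y - p))) hu hv huv
    have e : p + (u • a + v • b) • (y - p) = u • (p + a • (y - p)) + v • (p + b • (y - p)) := by
      have : p = (u + v) • p := by rw [huv, one_smul]
      simp only [smul_add, smul_smul, smul_eq_mul, add_smul]
      nth_rw 1 [this]
      rw [add_smul]; abel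
    simp only [e]; exact this
  have := hc.le_slope_of_hasDerivAt (mem_univ 0) (mem_univ 1) one_pos h3
  simp only [slope_def_field, zero_smul, add_zero, one_smul, add_sub_cancel, sub_zero, div_one] at this
  linarith

lemma le_of_support (F : ℝ → ℝ) (a b : ℝ) (hab : a ≤ b) (hF : ContinuousOn F (Icc a b))
    (h : ∀ t ∈ Ioc a b, ∃ (P : ℝ → ℝ) (d : ℝ), HasDerivAt P d t ∧ d ≤ 0 ∧ P t = F t ∧
      ∀ s ∈ Icc a b, P s ≤ F s) : F b ≤ F a := by
  have key := @image_le_of_liminf_slope_right_le_deriv_boundary (fun s => - F (-s)) (-b) (-a) ?_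
    (fun _ => - F b) (fun _ => 0) (by simp) continuousOn_const
    (fun x _ => hasDerivWithinAt_const _ _ _) ?_ (-a) (by simp [hab])
  · simpa using key
  · apply ContinuousOn.neg
    apply hF.comp continuousOn_neg
    intro s hs
    simp only [mem_Icc] at hs ⊢
    constructor <;> linarith [hs.1, hs.2]
  · intro τ hτ r hr
    obtain ⟨P, d, hP, hd, hPt, hle⟩ := h (-τ) ⟨by linarith [hτ.2], by linarith [hτ.1]⟩
    have hP2 : HasDerivAt (fun s => - P (-s)) d τ := by
      have := (hP.comp τ (hasDerivAt_neg τ)).fun_neg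
      simpa [Function.comp_def] using this
    have h1 : ∀ᶠ z in 𝓝[>] τ, slope (fun s => - P (-s)) τ z < r := by
      have := (hasDerivAt_iff_tendsto_slope.1 hP2).mono_left
        (nhdsWithin_mono τ (fun z (hz : z ∈ Ioi τ) => (ne_of_gt hz : z ≠ τ)))
      exact this.eventually_lt_const (by linarith)
    have h2 : ∀ᶠ z in 𝓝[>] τ, z ∈ Ioo τ (-a) := Ioo_mem_nhdsGT hτ.2
    apply Eventually.frequently
    filter_upwards [h1, h2] with z hz1 hz2
    refine lt_of_le_of_lt ?_ hz1
    simp only [slope_def_field]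
    have := hle (-z) ⟨by linarith [hz2.2], by linarith [hz2.1, hτ.1]⟩
    apply div_le_div_of_nonneg_right _ (by linarith [hz2.1])
    rw [hPt]; linarith

lemma weak_limit {H : Type*} [NormedAddCommGroup H] [InnerProductSpace ℝ H] [CompleteSpace H]
    (U : Ultrafilter ℝ) (x : ℝ → H) (R : ℝ) (hR : ∀ᶠ t in (U : Filter ℝ), ‖x t‖ ≤ R) :
    ∃ p : H, ∀ y : H, Tendsto (fun t => inner ℝ (x t) y : ℝ → ℝ) U (𝓝 (inner ℝ p y)) := by
  have h1 : ∀ y : H, ∃ c ∈ Icc (-(R * ‖y‖)) (R * ‖y‖),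
      Tendsto (fun t => inner ℝ (x t) y : ℝ → ℝ) U (𝓝 c) := by
    intro y
    apply (isCompact_Icc (a := -(R * ‖y‖)) (b := R * ‖y‖)).ultrafilter_le_nhds
      (U.map (fun t => inner ℝ (x t) y : ℝ → ℝ))
    simp only [le_principal_iff, Ultrafilter.coe_map, Filter.mem_map]
    filter_upwards [hR] with t ht
    have := (abs_real_inner_le_norm (x t) y).trans
      (mul_le_mul_of_nonneg_right ht (norm_nonneg y))
    exact abs_le.1 this
  choose ℓ hℓ1 hℓ2 using h1
  let L : H →ₗ[ℝ] ℝ :=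
    { toFun := ℓ
      map_add' := fun y z => tendsto_nhds_unique (hℓ2 (y + z))
        (by simpa [inner_add_right] using (hℓ2 y).add (hℓ2 z))
      map_smul' := fun c y => tendsto_nhds_unique (hℓ2 (c • y))
        (by simpa [inner_smul_right] using (hℓ2 y).const_mul c) }
  let L' : H →L[ℝ] ℝ := L.mkContinuous R (fun y => abs_le.2 (hℓ1 y))
  refine ⟨(InnerProductSpace.toDual ℝ H).symm L', fun y => ?_⟩
  rw [InnerProductSpace.toDual_symm_apply]
  exact hℓ2 y

lemma opial {H : Type*} [NormedAddCommGroup H] [InnerProductSpace ℝ H] [CompleteSpace H]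
    (x : ℝ → H) (R : ℝ) (hR : ∀ᶠ t in (atTop : Filter ℝ), ‖x t‖ ≤ R) (S : Set H)
    (hS : ∀ z ∈ S, ∃ c, Tendsto (fun t => inner ℝ (x t - z) (x t - z) : ℝ → ℝ) atTop (𝓝 c))
    (hcl : ∀ (U : Ultrafilter ℝ) (p : H), (U : Filter ℝ) ≤ atTop →
      (∀ y : H, Tendsto (fun t => inner ℝ (x t) y : ℝ → ℝ) U (𝓝 (inner ℝ p y))) → p ∈ S) :
    ∃ p ∈ S, ∀ y : H, Tendsto (fun t => inner ℝ (x t) y : ℝ → ℝ) atTop (𝓝 (inner ℝ p y)) := by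
  have huniq : ∀ (U V : Ultrafilter ℝ) (p q : H), (U : Filter ℝ) ≤ atTop → (V : Filter ℝ) ≤ atTop →
      (∀ y : H, Tendsto (fun t => inner ℝ (x t) y : ℝ → ℝ) U (𝓝 (inner ℝ p y))) →
      (∀ y : H, Tendsto (fun t => inner ℝ (x t) y : ℝ → ℝ) V (𝓝 (inner ℝ q y))) → p = q := by
    intro U V p q hU hV hp hq
    obtain ⟨c, hc⟩ := hS p (hcl U p hU hp)
    obtain ⟨d, hd⟩ := hS q (hcl V q hV hq)
    have h1 : Tendsto (fun t => inner ℝ (x t) (p - q) : ℝ → ℝ) atTop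
        (𝓝 ((inner ℝ p p - inner ℝ q q - (c - d)) / 2)) := by
      refine (((hc.sub hd).const_sub (inner ℝ p p - inner ℝ q q)).div_const 2).congr ?_
      intro t
      simp only [inner_sub_left, inner_sub_right, real_inner_comm (x t)]
      ring
    have e1 := tendsto_nhds_unique (hp (p - q)) (h1.mono_left hU)
    have e2 := tendsto_nhds_unique (hq (p - q)) (h1.mono_left hV)
    have : inner ℝ (p - q) (p - q) = (0 : ℝ) := by
      rw [inner_sub_left, e1, e2, sub_self]
    exact sub_eq_zero.1 (inner_self_eq_zero.1 this)
  let U0 : Ultrafilter ℝ := Ultrafilter.of atTop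
  have hU0 : (U0 : Filter ℝ) ≤ atTop := Ultrafilter.of_le atTop
  obtain ⟨p, hp⟩ := weak_limit U0 x R (hU0 hR)
  refine ⟨p, hcl U0 p hU0 hp, fun y => ?_⟩
  rw [tendsto_iff_ultrafilter]
  intro V hV
  obtain ⟨q, hq⟩ := weak_limit V x R (hV hR)
  rw [huniq U0 V p q hU0 hV hp hq]
  exact hq y

lemma ode_upper (β t1 L : ℝ) (hβ : 0 < β) (ht1 : 0 < t1) (q q' : ℝ → ℝ)
    (hq : ∀ t, t1 ≤ t → HasDerivAt q (q' t) t)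
    (hL : Tendsto (fun t => t * q' t + β * q t) atTop (𝓝 L)) :
    ∀ ε > 0, ∀ᶠ t in atTop, q t < L / β + ε := by
  intro ε hε
  have h1 : ∀ᶠ t in atTop, t * q' t + β * q t < L + β * ε / 2 :=
    hL.eventually_lt_const (by have := mul_pos hβ hε; linarith)
  obtain ⟨T0, hT0⟩ := eventually_atTop.1 h1
  set T := max T0 t1
  have hTpos : 0 < T := lt_of_lt_of_le ht1 (le_max_right _ _)
  set k := L / β + ε / 2 with hk
  have hbk : β * k = L + β * ε / 2 := by rw [hk]; field_simp
  have hd : ∀ t, T ≤ t → HasDerivAt (fun t => t ^ β * (q t - k))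
      ((β * t ^ (β - 1)) * (q t - k) + t ^ β * q' t) t := by
    intro t ht
    have htp : 0 < t := lt_of_lt_of_le hTpos ht
    exact (Real.hasDerivAt_rpow_const (Or.inl htp.ne')).mul
      ((hq t ((le_max_right _ _).trans ht)).sub_const k)
  have hanti : AntitoneOn (fun t => t ^ β * (q t - k)) (Ici T) := by
    apply antitoneOn_of_deriv_nonpos (convex_Ici T)
    · exact fun t ht => (hd t ht).continuousAt.continuousWithinAt
    · exact fun t ht => (hd t (interior_subset ht)).differentiableAt.differentiableWithinAt
    · intro t ht
      have ht' : T ≤ t := interior_subset ht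
      have htp : 0 < t := lt_of_lt_of_le hTpos ht'
      rw [(hd t ht').deriv]
      have e : t ^ β = t ^ (β - 1) * t := by
        rw [← Real.rpow_add_one htp.ne']; congr 1; ring
      rw [e]
      have h2 := hT0 t ((le_max_left _ _).trans ht')
      have h3 : 0 ≤ t ^ (β - 1) := Real.rpow_nonneg htp.le _
      have : β * t ^ (β - 1) * (q t - k) + t ^ (β - 1) * t * q' t
        = t ^ (β - 1) * (t * q' t + β * q t - β * k) := by ring
      rw [this]
      exact mul_nonpos_of_nonneg_of_nonpos h3 (by linarith)
  have hlim : Tendsto (fun t : ℝ => (T ^ β * (q T - k)) * t ^ (-β)) atTop (𝓝 0) := by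
    simpa using (tendsto_rpow_neg_atTop hβ).const_mul (T ^ β * (q T - k))
  have h4 := hlim.eventually_lt_const (show 0 < ε / 2 by linarith)
  filter_upwards [h4, eventually_ge_atTop T] with t h5 ht
  have htp : 0 < t := lt_of_lt_of_le hTpos ht
  have h6 : t ^ β * (q t - k) ≤ T ^ β * (q T - k) := hanti (self_mem_Ici) ht ht
  have h7 : 0 ≤ t ^ (-β) := Real.rpow_nonneg htp.le _
  have h8 := mul_le_mul_of_nonneg_right h6 h7
  have h9 : t ^ β * t ^ (-β) = 1 := by rw [← Real.rpow_add htp]; simp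
  have h10 : t ^ β * (q t - k) * t ^ (-β) = q t - k := by
    calc _ = (t ^ β * t ^ (-β)) * (q t - k) := by ring
      _ = _ := by rw [h9, one_mul]
  rw [h10] at h8
  linarith

lemma ode_lim (β t1 L : ℝ) (hβ : 0 < β) (ht1 : 0 < t1) (q q' : ℝ → ℝ)
    (hq : ∀ t, t1 ≤ t → HasDerivAt q (q' t) t)
    (hL : Tendsto (fun t => t * q' t + β * q t) atTop (𝓝 L)) :
    Tendsto q atTop (𝓝 (L / β)) := by
  rw [Metric.tendsto_nhds]
  intro ε hε
  have h1 := ode_upper β t1 L hβ ht1 q q' hq hL ε hε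
  have h2 := ode_upper β t1 (-L) hβ ht1 (fun t => - q t) (fun t => - q' t)
    (fun t ht => (hq t ht).neg) (hL.neg.congr (fun t => by ring)) ε hε
  filter_upwards [h1, h2] with t h3 h4
  rw [Real.dist_eq, abs_lt]
  rw [neg_div] at h4
  constructor <;> linarith

lemma anti_lim (f : ℝ → ℝ) (t1 B : ℝ) (hf : ∀ s t, t1 ≤ s → s ≤ t → f t ≤ f s)
    (hB : ∀ t, t1 ≤ t → B ≤ f t) : ∃ c, Tendsto f atTop (𝓝 c) := by
  have h1 : Antitone (fun t => f (max t t1)) := fun s t hst =>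
    hf _ _ (le_max_right _ _) (max_le_max_right _ hst)
  refine ⟨_, (tendsto_atTop_ciInf h1 ⟨B, ?_⟩).congr' ?_⟩
  · rintro _ ⟨t, rfl⟩
    exact hB _ (le_max_right _ _)
  · filter_upwards [eventually_ge_atTop t1] with t ht
    simp [ht]

section
set_option linter.unusedSectionVars false
variable {H : Type*} [NormedAddCommGroup H] [InnerProductSpace ℝ H] [CompleteSpace H]
    {m : ℕ} {g : Fin m → H → ℝ}
    {Q : Set (EuclideanSpace ℝ (Fin m))} {D : EuclideanSpace ℝ (Fin m) → ℝ}

lemma phi_eq (D : EuclideanSpace ℝ (Fin m) → ℝ) (y : H) : phi m g Q y = phiMu m g Q D 0 y := by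
  simp [phi, phiMu]

lemma cont_obj (hD : Continuous D) (μ : ℝ) (y : H) :
    Continuous (fun l : EuclideanSpace ℝ (Fin m) => ∑ i, l i * g i y - μ * D l) := by
  fun_prop

lemma exists_max (hQne : Q.Nonempty) (hQ : IsCompact Q) (hD : Continuous D) (μ : ℝ) (y : H) :
    ∃ a ∈ Q, phiMu m g Q D μ y = ∑ i, a i * g i y - μ * D a :=
  hQ.exists_sSup_image_eq hQne (cont_obj hD μ y).continuousOn

lemma le_phiMu (hQ : IsCompact Q) (hD : Continuous D) (μ : ℝ) (y : H)
    {a : EuclideanSpace ℝ (Fin m)} (ha : a ∈ Q) :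
    ∑ i, a i * g i y - μ * D a ≤ phiMu m g Q D μ y :=
  le_csSup (hQ.image (cont_obj hD μ y)).bddAbove (mem_image_of_mem _ ha)

lemma cont_phiMu (hQ : IsCompact Q) (hD : Continuous D) :
    Continuous (fun p : (Fin m → ℝ) × ℝ =>
      sSup ((fun l : EuclideanSpace ℝ (Fin m) => ∑ i, l i * p.1 i - p.2 * D l) '' Q)) := by
  apply hQ.continuous_sSup (f := fun (p : (Fin m → ℝ) × ℝ) (l : EuclideanSpace ℝ (Fin m)) =>
    ∑ i, l i * p.1 i - p.2 * D l)
  simp only [Function.HasUncurry.uncurry]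
  fun_prop

lemma quad_gap (hQ : IsCompact Q) (hD : Continuous D) {σ : ℝ}
    (hDsc : StrongConvexOn Q σ D) {μ : ℝ} (hμ : 0 < μ) (y : H)
    {a l : EuclideanSpace ℝ (Fin m)} (ha : a ∈ Q) (hl : l ∈ Q)
    (hmax : phiMu m g Q D μ y = ∑ i, a i * g i y - μ * D a) :
    ∑ i, l i * g i y - μ * D l ≤ phiMu m g Q D μ y - μ * σ / 4 * ∑ i, (l i - a i) ^ 2 := by
  have h1 := hDsc.2 ha hl (show (0:ℝ) ≤ 1/2 by norm_num) (show (0:ℝ) ≤ 1/2 by norm_num) (by norm_num)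
  have hmem := hDsc.1 ha hl (show (0:ℝ) ≤ 1/2 by norm_num) (show (0:ℝ) ≤ 1/2 by norm_num) (by norm_num)
  have h2 := le_phiMu (g := g) hQ hD μ y hmem
  beta_reduce at h1
  rw [EuclideanSpace.real_norm_sq_eq] at h1
  have e1 : ∑ i, ((1/2 : ℝ) • a + (1/2 : ℝ) • l).ofLp i * g i y
      = 1/2 * ∑ i, a i * g i y + 1/2 * ∑ i, l i * g i y := by
    rw [Finset.mul_sum, Finset.mul_sum, ← Finset.sum_add_distrib]
    apply Finset.sum_congr rfl
    intro i _
    simp; ring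
  have e2 : ∑ i, (a - l).ofLp i ^ 2 = ∑ i, (l i - a i) ^ 2 := by
    apply Finset.sum_congr rfl
    intro i _
    simp; ring
  rw [e2] at h1
  rw [e1] at h2
  simp only [smul_eq_mul] at h1
  have h3 := mul_le_mul_of_nonneg_left h1 hμ.le
  nlinarith

lemma grad_phiMu (hg : ∀ i, Differentiable ℝ (g i)) (hQne : Q.Nonempty)
    (hQ : IsCompact Q) (hD : Continuous D) {σ : ℝ} (hσ : 0 < σ)
    (hDsc : StrongConvexOn Q σ D) {μ : ℝ} (hμ : 0 < μ) (y : H)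
    {a : EuclideanSpace ℝ (Fin m)} (ha : a ∈ Q)
    (hmax : phiMu m g Q D μ y = ∑ i, a i * g i y - μ * D a) :
    gradient (phiMu m g Q D μ) y = ∑ i, a i • gradient (g i) y := by
  apply HasGradientAt.gradient
  rw [hasGradientAt_iff_hasFDerivAt]
  have hgf : ∀ i, HasFDerivAt (g i) (InnerProductSpace.toDual ℝ H (gradient (g i) y)) y :=
    fun i => (hg i y).hasGradientAt.hasFDerivAt
  have hS : HasFDerivAt (fun z => ∑ i, a i * g i z)
      (InnerProductSpace.toDual ℝ H (∑ i, a i • gradient (g i) y)) y := by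
    have := HasFDerivAt.fun_sum (u := Finset.univ) (fun i _ => (hgf i).const_mul (a i))
    have e : InnerProductSpace.toDual ℝ H (∑ i, a i • gradient (g i) y)
        = ∑ i, a i • InnerProductSpace.toDual ℝ H (gradient (g i) y) := by
      rw [map_sum]
      exact Finset.sum_congr rfl (fun i _ => by ext v; simp)
    rw [e]
    exact this
  set c := μ * σ / 4 with hc
  have hcpos : 0 < c := by positivity
  set N : H → ℝ := fun z => ∑ i, (g i z - g i y) ^ 2 / (4 * c) with hN
  have hNd : HasFDerivAt N (0 : H →L[ℝ] ℝ) y := by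
    have : ∀ i ∈ (Finset.univ : Finset (Fin m)),
        HasFDerivAt (fun z => (g i z - g i y) ^ 2 / (4 * c)) (0 : H →L[ℝ] ℝ) y := by
      intro i _
      have := (((hgf i).sub_const (g i y)).pow 2).mul_const ((4 * c)⁻¹)
      simpa [div_eq_mul_inv] using this
    simpa using HasFDerivAt.fun_sum this
  have hNy : N y = 0 := by simp [hN]
  have hlow : ∀ z, ∑ i, a i * g i z - μ * D a ≤ phiMu m g Q D μ z := fun z => le_phiMu hQ hD μ z ha
  have hup : ∀ z, phiMu m g Q D μ z ≤ ∑ i, a i * g i z - μ * D a + N z := by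
    intro z
    obtain ⟨l, hl, hle⟩ := exists_max (g := g) hQne hQ hD μ z
    have h1 := quad_gap (g := g) hQ hD hDsc hμ y ha hl hmax
    rw [hle]
    rw [hmax, ← hc] at h1
    have h2 : ∑ i, (l i * g i z - l i * g i y - a i * g i z + a i * g i y
        - c * (l i - a i) ^ 2) ≤ N z := by
      apply Finset.sum_le_sum
      intro i _
      rw [le_div_iff₀ (by positivity)]
      nlinarith [sq_nonneg (2 * c * (l i - a i) - (g i z - g i y))]
    simp only [Finset.sum_sub_distrib, Finset.sum_add_distrib, ← Finset.mul_sum] at h2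
    linarith
  have hR : HasFDerivAt (fun z => phiMu m g Q D μ z - ∑ i, a i * g i z) (0 : H →L[ℝ] ℝ) y := by
    rw [hasFDerivAt_iff_isLittleO] at hNd ⊢
    refine Asymptotics.IsBigO.trans_isLittleO ?_ hNd
    apply Asymptotics.IsBigO.of_norm_le
    intro z
    have h1 := hlow z
    have h2 := hup z
    simp only [hNy, _root_.zero_apply, sub_zero, hmax, Real.norm_eq_abs]
    rw [abs_le]
    constructor
    · linarith [le_abs_self (N z), neg_abs_le (N z), abs_nonneg (N z)]
    · linarith [le_abs_self (N z)]
  have := hR.fun_add hS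
  simp only [sub_add_cancel, zero_add] at this
  exact this

end

lemma tail_fun (t0 : ℝ) (ht0 : 0 < t0) (μ : ℝ → ℝ) (hμpos : ∀ t ∈ Set.Ici t0, 0 < μ t)
    (hc : ContinuousOn μ (Ici t0))
    (hA1 : IntegrableOn (fun t => t * μ t) (Set.Ioi t0)) :
    ∃ N : ℝ → ℝ, (∀ t, t0 + 1 ≤ t → 0 ≤ N t) ∧
      (∀ t, t0 + 1 ≤ t → HasDerivAt N (-(t * μ t)) t) ∧ Tendsto N atTop (𝓝 0) := by
  set I := ∫ s in Ioi t0, s * μ s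
  have hii : ∀ t, t0 + 1 ≤ t → IntervalIntegrable (fun t => t * μ t) volume t0 t := by
    intro t ht
    rw [intervalIntegrable_iff_integrableOn_Ioc_of_le (by linarith)]
    exact hA1.mono_set Ioc_subset_Ioi_self
  refine ⟨fun t => I - ∫ s in t0..t, s * μ s, ?_, ?_, ?_⟩
  · intro t ht
    have h1 := intervalIntegral.integral_interval_add_Ioi hA1
      (hA1.mono_set (Ioi_subset_Ioi (by linarith : t0 ≤ t)))
    have h2 : 0 ≤ ∫ s in Ioi t, s * μ s := by
      apply setIntegral_nonneg measurableSet_Ioi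
      intro s hs
      have hs' : t < s := hs
      exact mul_nonneg (by linarith) (hμpos s (by simp; linarith)).le
    simp only [I]
    linarith
  · intro t ht
    have hco : ContinuousOn (fun t => t * μ t) (Ioi t0) :=
      (continuousOn_id.mul (hc.mono Ioi_subset_Ici_self))
    have htm : t ∈ Ioi t0 := by simp; linarith
    exact (intervalIntegral.integral_hasDerivAt_right (hii t ht)
      (hco.stronglyMeasurableAtFilter isOpen_Ioi t htm)
      (hco.continuousAt (isOpen_Ioi.mem_nhds htm))).const_sub I
  · simpa [I] using (intervalIntegral_tendsto_integral_Ioi t0 hA1 tendsto_id).const_sub I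

lemma energy_alg (α lam t : ℝ) (ht : 0 < t) (h2 : 2 ≤ lam) (hα : lam ≤ α - 1)
    (θ C mu mu' d n1 n3 xv uv : ℝ) (hθ : 0 ≤ θ) (hn1 : 0 ≤ n1) (hmu' : mu' ≤ 0) (hd : d ≤ C)
    (huv : θ - C * mu ≤ uv) :
    2 * t * θ + t ^ 2 * (xv + mu' * (C - d)) + t * n1 + t ^ 2 * (-(α / t) * n1 - xv)
      + lam * ((α - 1) * n3 + n3 + t * n1 + t * (-(α / t) * n3 - uv)) + lam * C * -(t * mu) ≤ 0 := by
  have e1 : t ^ 2 * (-(α / t) * n1 - xv) = - (α * t * n1) - t ^ 2 * xv := by field_simp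
  have e2 : t * (-(α / t) * n3 - uv) = - (α * n3) - t * uv := by field_simp
  rw [e1, e2]
  have h3 : t ^ 2 * (mu' * (C - d)) ≤ 0 :=
    mul_nonpos_of_nonneg_of_nonpos (sq_nonneg t)
      (mul_nonpos_of_nonpos_of_nonneg hmu' (by linarith))
  have h4 : 0 ≤ lam * t * (uv - (θ - C * mu)) :=
    mul_nonneg (by nlinarith) (by linarith)
  have h5 : 0 ≤ (lam - 2) * (t * θ) := mul_nonneg (by linarith) (by positivity)
  have h6 : 0 ≤ (α - 1 - lam) * (t * n1) := mul_nonneg (by linarith) (by positivity)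
  linarith

lemma energy_low {H : Type*} [NormedAddCommGroup H] [InnerProductSpace ℝ H]
    (α lam t : ℝ) (u v : H) :
    lam * (α - 1 - lam) / 2 * inner ℝ u u ≤
    t ^ 2 * inner ℝ v v / 2 + lam * ((α - 1) / 2 * inner ℝ u u + t * inner ℝ u v) := by
  have h : (0:ℝ) ≤ inner ℝ (lam • u + t • v) (lam • u + t • v) := real_inner_self_nonneg
  simp only [inner_add_left, inner_add_right, inner_smul_left, inner_smul_right,
    real_inner_comm u v, conj_trivial] at h
  nlinarith

end S16

set_option maxHeartbeats 2000000 in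
open Topology in

theorem statement16 {H : Type*} [NormedAddCommGroup H] [InnerProductSpace ℝ H]
    [CompleteSpace H]
    (m : ℕ) (hm : 1 ≤ m)
    (g : Fin m → H → ℝ) (hg : ∀ i, ConvexOn ℝ Set.univ (g i))
    (hgdiff : ∀ i, Differentiable ℝ (g i))
    -- each `∇ g i` is Lipschitz continuous on every bounded set
    (hgradLip : ∀ i, ∀ s : Set H, Bornology.IsBounded s →
      ∃ Li : ℝ, ∀ x ∈ s, ∀ y ∈ s,
        ‖gradient (g i) x - gradient (g i) y‖ ≤ Li * ‖x - y‖)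
    (Q : Set (EuclideanSpace ℝ (Fin m))) (hQne : Q.Nonempty) (hQcomp : IsCompact Q)
    (hQconv : Convex ℝ Q) (hQpos : ∀ l ∈ Q, ∀ i, 0 ≤ l i)
    (D : EuclideanSpace ℝ (Fin m) → ℝ) (hDcont : Continuous D)
    (hDnonneg : ∀ l ∈ Q, 0 ≤ D l)
    (σ : ℝ) (hσ : 0 < σ) (hDsc : StrongConvexOn Q σ D)
    (hDinf : IsGLB (D '' Q) 0)
    (C : ℝ) (hC : IsLUB (D '' Q) C)
    -- `D` is differentiable on a neighborhood `U` of `Q`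
    (U : Set (EuclideanSpace ℝ (Fin m))) (hUopen : IsOpen U) (hQU : Q ⊆ U)
    (hDdiff : ∀ l ∈ U, DifferentiableAt ℝ D l)
    -- `argmin φ ≠ ∅`
    (hargmin : ∃ xs : H, ∀ y : H, phi m g Q xs ≤ phi m g Q y)
    -- time data
    (t0 α : ℝ) (ht0 : 0 < t0) (hα : 3 < α)
    -- `μ` is continuously differentiable, positive and nonincreasing on `[t0, ∞)`
    (μ μ' : ℝ → ℝ) (hμpos : ∀ t ∈ Set.Ici t0, 0 < μ t)
    (hμderiv : ∀ t ∈ Set.Ici t0, HasDerivAt μ (μ' t) t)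
    (hμ'cont : ContinuousOn μ' (Set.Ici t0))
    (hμanti : AntitoneOn μ (Set.Ici t0))
    -- `x` is a twice continuously differentiable solution of the inertial system
    (x x' x'' : ℝ → H)
    (hx' : ∀ t ∈ Set.Ici t0, HasDerivAt x (x' t) t)
    (hx'' : ∀ t ∈ Set.Ici t0, HasDerivAt x' (x'' t) t)
    (hx''cont : ContinuousOn x'' (Set.Ici t0))
    (hODE : ∀ t ∈ Set.Ici t0,
      x'' t + (α / t) • x' t + gradient (phiMu m g Q D (μ t)) (x t) = 0)
    -- Assumption A
    (hA1 : MeasureTheory.IntegrableOn (fun t => t * μ t) (Set.Ioi t0))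
    (hA2 : MeasureTheory.IntegrableOn (fun t => t ^ 2 * |μ' t|) (Set.Ioi t0))
 :
    ∃ xinf : H, (∀ y : H, phi m g Q xinf ≤ phi m g Q y) ∧
      ∀ y : H, Filter.Tendsto (fun t => inner ℝ (x t) y : ℝ → ℝ)
        Filter.atTop (nhds (inner ℝ xinf y : ℝ)) := by
  obtain ⟨xs, hxs⟩ := hargmin
  set φs := phi m g Q xs with hφs
  have hμc : ContinuousOn μ (Ici t0) := fun t ht => (hμderiv t ht).continuousAt.continuousWithinAt
  obtain ⟨N, hN0, hNd, hNlim⟩ := S16.tail_fun t0 ht0 μ hμpos hμc hA1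
  have hDC : ∀ l ∈ Q, D l ≤ C := fun l hl => hC.1 (mem_image_of_mem D hl)
  have hC0 : 0 ≤ C := by
    obtain ⟨l, hl⟩ := hQne
    exact (hDnonneg l hl).trans (hDC l hl)
  set t1 := t0 + 1 with ht1
  have hge : ∀ t, t1 ≤ t → t ∈ Ici t0 := fun t ht => by simp only [mem_Ici]; linarith
  have hpos : ∀ t, t1 ≤ t → 0 < t := fun t ht => by linarith
  have hμ'np : ∀ t, t1 ≤ t → μ' t ≤ 0 := by
    intro t ht
    have h1 : derivWithin μ (Ici t0) t ≤ 0 := hμanti.derivWithin_nonpos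
    rwa [(hμderiv t (hge t ht)).hasDerivWithinAt.derivWithin
      (uniqueDiffOn_Ici t0 t (hge t ht))] at h1
  -- comparison of phi and phiMu
  have hphi_le : ∀ t, t1 ≤ t → phi m g Q (x t) ≤ phiMu m g Q D (μ t) (x t) + C * μ t := by
    intro t ht
    obtain ⟨a, ha, hae⟩ := S16.exists_max (g := g) hQne hQcomp hDcont 0 (x t)
    have h1 := S16.le_phiMu (g := g) hQcomp hDcont (μ t) (x t) ha
    have h2 := mul_le_mul_of_nonneg_left (hDC a ha) (hμpos t (hge t ht)).le
    rw [S16.phi_eq D, hae]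
    linarith
  have hphiMu_le : ∀ t, t1 ≤ t → ∀ z, phiMu m g Q D (μ t) z ≤ phi m g Q z := by
    intro t ht z
    obtain ⟨a, ha, hae⟩ := S16.exists_max (g := g) hQne hQcomp hDcont (μ t) z
    have h1 := S16.le_phiMu (g := g) hQcomp hDcont 0 z ha
    have h2 := mul_nonneg (hμpos t (hge t ht)).le (hDnonneg a ha)
    rw [S16.phi_eq D, hae]
    linarith
  set ψ : ℝ → ℝ := fun t => phiMu m g Q D (μ t) (x t) with hψ
  have hθ : ∀ t, t1 ≤ t → 0 ≤ ψ t - φs + C * μ t := fun t ht => by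
    have h1 := hphi_le t ht
    have h2 := hxs (x t)
    simp only [hψ]; linarith
  have hxc : ContinuousOn x (Ici t1) := fun t ht =>
    (hx' t (hge t ht)).continuousAt.continuousWithinAt
  have hx'c : ContinuousOn x' (Ici t1) := fun t ht =>
    (hx'' t (hge t ht)).continuousAt.continuousWithinAt
  have hμc1 : ContinuousOn μ (Ici t1) := fun t ht =>
    (hμderiv t (hge t ht)).continuousAt.continuousWithinAt
  have hNc : ContinuousOn N (Ici t1) := fun t ht =>
    (hNd t ht).continuousAt.continuousWithinAt
  have hψc : ContinuousOn ψ (Ici t1) := by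
    have h1 : ContinuousOn (fun t => ((fun i => g i (x t), μ t) : (Fin m → ℝ) × ℝ)) (Ici t1) := by
      apply ContinuousOn.prodMk _ hμc1
      apply continuousOn_pi.2
      intro i
      exact (hgdiff i).continuous.comp_continuousOn hxc
    have h2 := (S16.cont_phiMu hQcomp hDcont).comp_continuousOn h1
    simp only [hψ, phiMu]
    simp only [Function.comp_def] at h2
    exact h2
  -- energy
  set E : ℝ → H → ℝ → ℝ := fun lam z t =>
    t ^ 2 * (ψ t - φs + C * μ t) + t ^ 2 * inner ℝ (x' t) (x' t) / 2
      + lam * ((α - 1) / 2 * inner ℝ (x t - z) (x t - z) + t * inner ℝ (x t - z) (x' t))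
      + lam * C * N t with hE
  have hEanti : ∀ lam z, 2 ≤ lam → lam ≤ α - 1 → phi m g Q z ≤ φs → ∀ s t, t1 ≤ s → s ≤ t →
      E lam z t ≤ E lam z s := by
    intro lam z hl2 hlα hz s t hs hst
    apply S16.le_of_support (E lam z) s t hst
    · have hsub : Icc s t ⊆ Ici t1 := fun r hr => hs.trans hr.1
      have k1 := hψc.mono hsub
      have k2 := hxc.mono hsub
      have k3 := hx'c.mono hsub
      have k4 := hμc1.mono hsub
      have k5 := hNc.mono hsub
      simp only [hE]
      fun_prop
    · intro r hr
      have hr1 : t1 ≤ r := hs.trans hr.1.le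
      have hr0 := hpos r hr1
      obtain ⟨a, ha, hae⟩ := S16.exists_max (g := g) hQne hQcomp hDcont (μ r) (x r)
      have hgrad := S16.grad_phiMu hgdiff hQne hQcomp hDcont hσ hDsc (hμpos r (hge r hr1)) (x r)
        ha hae
      set v := ∑ i, a i • gradient (g i) (x r) with hv
      have hode : x'' r = -(α / r) • x' r - v := by
        have := hODE r (hge r hr1)
        rw [hgrad] at this
        rw [neg_smul]
        have h2 := eq_neg_of_add_eq_zero_left this
        rw [eq_sub_iff_add_eq, eq_neg_iff_add_eq_zero, ← this]; abel
      have dx := hx' r (hge r hr1)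
      have dx' := hx'' r (hge r hr1)
      have dμ := hμderiv r (hge r hr1)
      have du := dx.sub_const z
      have dS : HasDerivAt (fun s => ∑ i, a i * g i (x s)) (inner ℝ (x' r) v) r := by
        have h1 : ∀ i ∈ (Finset.univ : Finset (Fin m)), HasDerivAt (fun s => a i * g i (x s))
            (a i * inner ℝ (gradient (g i) (x r)) (x' r)) r := by
          intro i _
          have h0 := (hgdiff i (x r)).hasGradientAt.hasFDerivAt.comp_hasDerivAt r dx
          rw [InnerProductSpace.toDual_apply_apply] at h0
          have h0' : HasDerivAt (fun s => g i (x s))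
            (inner ℝ (gradient (g i) (x r)) (x' r)) r := h0
          exact h0'.const_mul (a i)
        have h2 : HasDerivAt (fun s => ∑ i, a i * g i (x s))
          (∑ i, a i * inner ℝ (gradient (g i) (x r)) (x' r)) r := HasDerivAt.fun_sum h1
        have e : inner ℝ (x' r) v = ∑ i, a i * inner ℝ (gradient (g i) (x r)) (x' r) := by
          rw [hv, inner_sum]
          apply Finset.sum_congr rfl
          intro i _
          rw [inner_smul_right, real_inner_comm]
        rw [e]
        exact h2
      have d1 := ((hasDerivAt_id r).fun_pow 2).fun_mul
        ((dS.fun_sub (dμ.mul_const (D a))).sub_const φs |>.fun_add (dμ.const_mul C))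
      have d2 := (((hasDerivAt_id r).fun_pow 2).fun_mul (dx'.inner ℝ dx')).div_const 2
      have d3 := (((du.inner ℝ du).const_mul ((α - 1) / 2)).fun_add
        ((hasDerivAt_id r).fun_mul (du.inner ℝ dx'))).const_mul lam
      have d4 := (hNd r hr1).const_mul (lam * C)
      have dP := ((d1.fun_add d2).fun_add d3).fun_add d4
      refine ⟨_, _, dP, ?_, ?_, ?_⟩
      · have hn1 : (0:ℝ) ≤ inner ℝ (x' r) (x' r) := real_inner_self_nonneg
        have huv : (ψ r - φs + C * μ r) - C * μ r ≤ inner ℝ (x r - z) v := by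
          have h1 : ∑ i, a i * (g i (x r) - g i z) ≤ inner ℝ (x r - z) v := by
            rw [hv, inner_sum]
            apply Finset.sum_le_sum
            intro i _
            rw [inner_smul_right]
            apply mul_le_mul_of_nonneg_left _ (hQpos a ha i)
            have := S16.grad_ineq (hg i) (hgdiff i) (x r) z
            rw [← neg_sub, inner_neg_right, real_inner_comm] at this
            linarith
          have h2 : phiMu m g Q D (μ r) z ≤ φs := (hphiMu_le r hr1 z).trans hz
          have h3 := S16.le_phiMu (g := g) hQcomp hDcont (μ r) z ha
          simp only [mul_sub, Finset.sum_sub_distrib] at h1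
          simp only [hψ, hae]
          linarith
        have key := S16.energy_alg α lam r hr0 hl2 hlα (ψ r - φs + C * μ r) C (μ r) (μ' r) (D a)
          (inner ℝ (x' r) (x' r)) (inner ℝ (x r - z) (x' r)) (inner ℝ (x' r) v)
          (inner ℝ (x r - z) v) (hθ r hr1) hn1 (hμ'np r hr1) (hDC a ha) huv
        refine le_trans (le_of_eq ?_) key
        simp only [hψ, hae, hode, inner_sub_right, inner_sub_left, inner_smul_right,
          inner_smul_left, id, conj_trivial, real_inner_comm (x' r)]
        push_cast
        ring
      · simp only [hE, hψ, hae, id]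
      · intro w hw
        have h1 := S16.le_phiMu (g := g) hQcomp hDcont (μ w) (x w) ha
        simp only [hE, hψ, id]
        have h2 := mul_le_mul_of_nonneg_left h1 (sq_nonneg w)
        linarith
  have hElow : ∀ lam z, 2 ≤ lam → lam ≤ α - 1 → ∀ t, t1 ≤ t →
      t ^ 2 * (ψ t - φs + C * μ t) + lam * (α - 1 - lam) / 2 * inner ℝ (x t - z) (x t - z)
        ≤ E lam z t := by
    intro lam z hl2 hlα t ht
    have h1 := S16.energy_low α lam t (x t - z) (x' t)
    have h2 : 0 ≤ lam * C * N t := mul_nonneg (mul_nonneg (by linarith) hC0) (hN0 t ht)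
    simp only [hE]
    linarith
  have hElim : ∀ lam z, 2 ≤ lam → lam ≤ α - 1 → phi m g Q z ≤ φs →
      ∃ c, Tendsto (E lam z) atTop (𝓝 c) := by
    intro lam z hl2 hlα hz
    apply S16.anti_lim (E lam z) t1 0 (hEanti lam z hl2 hlα hz)
    intro t ht
    refine le_trans ?_ (hElow lam z hl2 hlα t ht)
    have h1 := mul_nonneg (sq_nonneg t) (hθ t ht)
    have h2 : (0:ℝ) ≤ inner ℝ (x t - z) (x t - z) := real_inner_self_nonneg
    have h3 : 0 ≤ lam * (α - 1 - lam) / 2 * inner ℝ (x t - z) (x t - z) :=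
      mul_nonneg (div_nonneg (mul_nonneg (by linarith) (by linarith)) (by norm_num)) h2
    linarith
  -- bounds
  set K := E 2 xs t1 with hK
  have hEK : ∀ t, t1 ≤ t → E 2 xs t ≤ K := fun t ht =>
    hEanti 2 xs le_rfl (by linarith) le_rfl t1 t le_rfl ht
  have hbd : ∀ t, t1 ≤ t → ‖x t‖ ≤ Real.sqrt (K / (α - 3)) + ‖xs‖ := by
    intro t ht
    have h1 := (hElow 2 xs le_rfl (by linarith) t ht).trans (hEK t ht)
    have h2 := mul_nonneg (sq_nonneg t) (hθ t ht)
    rw [real_inner_self_eq_norm_sq] at h1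
    have h3 : ‖x t - xs‖ ≤ Real.sqrt (K / (α - 3)) := by
      apply Real.le_sqrt_of_sq_le
      rw [le_div_iff₀ (by linarith)]
      linarith
    have h4 := norm_sub_norm_le (x t) xs
    linarith
  have hθlim : Tendsto (fun t => K / t ^ 2) atTop (𝓝 0) :=
    tendsto_const_nhds.div_atTop (tendsto_pow_atTop (by norm_num))
  have hphiup : ∀ t, t1 ≤ t → phi m g Q (x t) ≤ φs + K / t ^ 2 := by
    intro t ht
    have h1 := (hElow 2 xs le_rfl (by linarith) t ht).trans (hEK t ht)
    have h2 : (0:ℝ) ≤ inner ℝ (x t - xs) (x t - xs) := real_inner_self_nonneg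
    have h3 : 0 ≤ 2 * (α - 1 - 2) / 2 * inner ℝ (x t - xs) (x t - xs) :=
      mul_nonneg (by linarith) h2
    have h4 : ψ t - φs + C * μ t ≤ K / t ^ 2 := by
      rw [le_div_iff₀ (pow_pos (hpos t ht) 2)]
      linarith
    have h5 := hphi_le t ht
    simp only [hψ] at h4
    linarith
  refine (S16.opial x _ (eventually_atTop.2 ⟨t1, hbd⟩) {z | phi m g Q z ≤ φs} ?_ ?_).elim
    (fun p hp => ⟨p, fun y => le_trans hp.1 (hxs y), hp.2⟩)
  · intro z hz
    obtain ⟨c, hc⟩ := hElim 2 z le_rfl (by linarith) hz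
    obtain ⟨d, hd⟩ := hElim (α - 1) z (by linarith) le_rfl hz
    have h1 : Tendsto (fun t => t * (2 * inner ℝ (x t - z) (x' t))
        + (α - 1) * inner ℝ (x t - z) (x t - z)) atTop
        (𝓝 (2 * ((d - c) / (α - 3) - C * 0))) := by
      refine ((((hd.sub hc).div_const (α - 3)).sub (hNlim.const_mul C)).const_mul 2).congr ?_
      intro t
      have : α - 3 ≠ 0 := by linarith
      simp only [hE]
      field_simp
      ring
    refine ⟨_, S16.ode_lim (α - 1) t1 _ (by linarith) (by linarith)
      (fun t => inner ℝ (x t - z) (x t - z)) (fun t => 2 * inner ℝ (x t - z) (x' t)) ?_ h1⟩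
    intro t ht
    have du := (hx' t (hge t ht)).sub_const z
    have := du.inner ℝ du
    rw [real_inner_comm (x t - z) (x' t), ← two_mul] at this
    exact this
  · intro U p hU hp
    obtain ⟨a, ha, hae⟩ := S16.exists_max (g := g) hQne hQcomp hDcont 0 p
    have h1 : ∀ t, t1 ≤ t → phi m g Q p + inner ℝ (x t) (∑ i, a i • gradient (g i) p)
        - inner ℝ p (∑ i, a i • gradient (g i) p) ≤ φs + K / t ^ 2 := by
      intro t ht
      refine le_trans ?_ (hphiup t ht)
      have h2 := S16.le_phiMu (g := g) hQcomp hDcont 0 (x t) ha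
      rw [S16.phi_eq D, S16.phi_eq D, hae]
      have h3 : ∑ i, a i * (g i p + inner ℝ (gradient (g i) p) (x t - p)) ≤ ∑ i, a i * g i (x t) :=
        Finset.sum_le_sum (fun i _ => mul_le_mul_of_nonneg_left
          (S16.grad_ineq (hg i) (hgdiff i) p (x t)) (hQpos a ha i))
      have h4 : inner ℝ (x t) (∑ i, a i • gradient (g i) p)
          - inner ℝ p (∑ i, a i • gradient (g i) p)
          = ∑ i, a i * inner ℝ (gradient (g i) p) (x t - p) := by
        rw [← inner_sub_left, inner_sum]
        apply Finset.sum_congr rfl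
        intro i _
        rw [inner_smul_right, real_inner_comm]
      simp only [mul_add, Finset.sum_add_distrib] at h3
      linarith
    have h5 := ((hp (∑ i, a i • gradient (g i) p)).const_add (phi m g Q p)).sub_const
      (inner ℝ p (∑ i, a i • gradient (g i) p))
    have h6 : Tendsto (fun t => φs + K / t ^ 2) U (𝓝 (φs + 0)) :=
      (hθlim.const_add φs).mono_left hU
    have h7 := le_of_tendsto_of_tendsto h5 h6 (hU (eventually_atTop.2 ⟨t1, h1⟩))
    change phi m g Q p ≤ φs
    linarith
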